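/- Let G be a simple graph on {1,…,n}. Suppose there exists a nonzero element P ∈ E_n such that x_{ij}·P = 0 for every edge {i,j} of G. Then E_G is finite-dimensional as a ℚ-vector space. If moreover P ∈ E_G and P is homogeneous of degree d, then E_G^e = 0 for all e > d and E_G^d = ℚ·P. -/

import Mathlib

open scoped TensorProduct

namespace FK

/-- Defining relations of the Fomin–Kirillov algebra `E n`, with generators indexed by
ordered pairs `(i, j)`; we also impose `x_{ii} = 0` and the antisymmetry `x_{ji} = -x_{ij}`,
so that the generators of the algebra are the `x_{ij}` for `i < j`. -/
inductive Rel (n : ℕ) : FreeAlgebra ℚ (Fin n × Fin n) → FreeAlgebra ℚ (Fin n × Fin n) → Prop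
  | diag (i : Fin n) : Rel n (FreeAlgebra.ι ℚ (i, i)) 0
  | antisymm (i j : Fin n) (hij : i ≠ j) :
      Rel n (FreeAlgebra.ι ℚ (j, i)) (-FreeAlgebra.ι ℚ (i, j))
  | square (i j : Fin n) (hij : i ≠ j) :
      Rel n (FreeAlgebra.ι ℚ (i, j) * FreeAlgebra.ι ℚ (i, j)) 0
  | comm (i j k l : Fin n) (h : List.Nodup [i, j, k, l]) :
      Rel n (FreeAlgebra.ι ℚ (i, j) * FreeAlgebra.ι ℚ (k, l))
        (FreeAlgebra.ι ℚ (k, l) * FreeAlgebra.ι ℚ (i, j))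
  | cyclic (i j k : Fin n) (h : List.Nodup [i, j, k]) :
      Rel n (FreeAlgebra.ι ℚ (i, j) * FreeAlgebra.ι ℚ (j, k)
        + FreeAlgebra.ι ℚ (j, k) * FreeAlgebra.ι ℚ (k, i)
        + FreeAlgebra.ι ℚ (k, i) * FreeAlgebra.ι ℚ (i, j)) 0

/-- The Fomin–Kirillov algebra `E n`. -/
abbrev E (n : ℕ) : Type := RingQuot (Rel n)

/-- The generator `x_{ij}` of `E n`. -/
noncomputable def x (n : ℕ) (i j : Fin n) : E n :=
  RingQuot.mkAlgHom ℚ (Rel n) (FreeAlgebra.ι ℚ (i, j))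

/-- The product of generators `x_{i₁j₁} ⋯ x_{i_d j_d}` given by a list of pairs. -/
noncomputable def word (n : ℕ) (l : List (Fin n × Fin n)) : E n :=
  (l.map fun p => x n p.1 p.2).prod

/-- The degree-`d` component of `E n`: the span of products of `d` generators. -/
def degSpan (n : ℕ) (d : ℕ) : Submodule ℚ (E n) :=
  Submodule.span ℚ {y | ∃ l : List (Fin n × Fin n),
    (∀ p ∈ l, p.1 ≠ p.2) ∧ l.length = d ∧ y = word n l}

/-- The Fomin–Kirillov algebra of a graph `G`: the subalgebra of `E n` generated by the
`x_{ij}` with `{i,j}` an edge of `G`. -/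
def EG (n : ℕ) (G : SimpleGraph (Fin n)) : Subalgebra ℚ (E n) :=
  Algebra.adjoin ℚ {y | ∃ i j : Fin n, G.Adj i j ∧ y = x n i j}

/-- The degree-`d` component `E_G^d = E_G ∩ E_n^d`. -/
def EGdeg (n : ℕ) (G : SimpleGraph (Fin n)) (d : ℕ) : Submodule ℚ (E n) :=
  (EG n G).toSubmodule ⊓ degSpan n d

/-- The positive-degree part `E_G⁺` of `E_G`. -/
def EGplus (n : ℕ) (G : SimpleGraph (Fin n)) : Submodule ℚ (E n) :=
  ⨆ d : ℕ, ⨆ _ : 1 ≤ d, EGdeg n G d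


section Proof

open TensorProduct Polynomial

variable {n : ℕ}

theorem x_self (i : Fin n) : x n i i = 0 := by
  have := RingQuot.mkAlgHom_rel ℚ (Rel.diag i)
  simpa [x] using this

theorem x_anti (i j : Fin n) : x n j i = - x n i j := by
  by_cases hij : i = j
  · subst hij; simp [x_self]
  · have := RingQuot.mkAlgHom_rel ℚ (Rel.antisymm i j hij)
    simpa [x] using this

theorem x_sq (i j : Fin n) : x n i j * x n i j = 0 := by
  by_cases hij : i = j
  · subst hij; simp [x_self]
  · have := RingQuot.mkAlgHom_rel ℚ (Rel.square i j hij)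
    simpa [x] using this

theorem x_comm (i j k l : Fin n) (h : List.Nodup [i, j, k, l]) :
    x n i j * x n k l = x n k l * x n i j := by
  have := RingQuot.mkAlgHom_rel ℚ (Rel.comm i j k l h)
  simpa [x] using this

theorem x_cyc (i j k : Fin n) (h : List.Nodup [i, j, k]) :
    x n i j * x n j k + x n j k * x n k i + x n k i * x n i j = 0 := by
  have := RingQuot.mkAlgHom_rel ℚ (Rel.cyclic i j k h)
  simpa [x] using this

/-- The relations of `E n` for a family `f` in an arbitrary algebra. -/
structure Good {A : Type*} [Ring A] (f : Fin n → Fin n → A) : Prop where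
  diag : ∀ i, f i i = 0
  anti : ∀ i j, i ≠ j → f j i = - f i j
  sq : ∀ i j, i ≠ j → f i j * f i j = 0
  comm : ∀ i j k l, List.Nodup [i, j, k, l] → f i j * f k l = f k l * f i j
  cyc : ∀ i j k, List.Nodup [i, j, k] →
    f i j * f j k + f j k * f k i + f k i * f i j = 0

theorem good_x : Good (x n) :=
  ⟨x_self, fun i j _ => x_anti i j, fun i j _ => x_sq i j, x_comm, x_cyc⟩

/-- Universal property of `E n`. -/
noncomputable def liftE {A : Type*} [Ring A] [Algebra ℚ A] (f : Fin n → Fin n → A)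
    (hf : Good f) : E n →ₐ[ℚ] A :=
  RingQuot.liftAlgHom ℚ ⟨FreeAlgebra.lift ℚ (fun p : Fin n × Fin n => f p.1 p.2), by
    intro a b hab
    cases hab with
    | diag i => simp [hf.diag]
    | antisymm i j hij => simpa using hf.anti i j hij
    | square i j hij => simpa using hf.sq i j hij
    | comm i j k l h => simpa using hf.comm i j k l h
    | cyclic i j k h => simpa using hf.cyc i j k h⟩

theorem liftE_x {A : Type*} [Ring A] [Algebra ℚ A] (f : Fin n → Fin n → A)
    (hf : Good f) (i j : Fin n) : liftE f hf (x n i j) = f i j := by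
  simp [liftE, x]

theorem E_induction {p : E n → Prop} (halg : ∀ r : ℚ, p (algebraMap ℚ (E n) r))
    (hx : ∀ i j, p (x n i j)) (hmul : ∀ a b, p a → p b → p (a * b))
    (hadd : ∀ a b, p a → p b → p (a + b)) (a : E n) : p a := by
  obtain ⟨b, rfl⟩ := RingQuot.mkAlgHom_surjective ℚ (Rel n) a
  induction b using FreeAlgebra.induction with
  | grade0 r => simpa using halg r
  | grade1 q => exact hx q.1 q.2
  | mul a b ha hb => simpa using hmul _ _ ha hb
  | add a b ha hb => simpa using hadd _ _ ha hb

theorem good_perm (s : Equiv.Perm (Fin n)) : Good (fun i j => x n (s i) (s j)) where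
  diag i := x_self _
  anti i j _ := x_anti _ _
  sq i j _ := x_sq _ _
  comm i j k l h := x_comm _ _ _ _ (by simpa using h)
  cyc i j k h := x_cyc _ _ _ (by simpa using h)

/-- The action of permutations on `E n`. -/
noncomputable def act (s : Equiv.Perm (Fin n)) : E n →ₐ[ℚ] E n := liftE _ (good_perm s)

theorem act_x (s : Equiv.Perm (Fin n)) (i j : Fin n) : act s (x n i j) = x n (s i) (s j) :=
  liftE_x _ _ _ _

theorem act_act (s t : Equiv.Perm (Fin n)) (a : E n) : act s (act t a) = act (s * t) a := by
  induction a using E_induction with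
  | halg r => simp
  | hx i j => simp [act_x]
  | hmul a b ha hb => simp [ha, hb]
  | hadd a b ha hb => simp [ha, hb]

theorem act_one (a : E n) : act 1 a = a := by
  induction a using E_induction with
  | halg r => simp
  | hx i j => simp [act_x]
  | hmul a b ha hb => simp [ha, hb]
  | hadd a b ha hb => simp [ha, hb]

/-- Linear operators on `E n ⊗ E n`. -/
abbrev Op (n : ℕ) : Type := Module.End ℚ (E n ⊗[ℚ] E n)

noncomputable instance ringOp : Ring (Op n) :=
  letI : Neg (Op n) := ⟨fun f => (-1 : ℚ) • f⟩
  { (inferInstance : Semiring (Op n)) with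
    neg := fun f => (-1 : ℚ) • f
    zsmul := zsmulRec
    neg_add_cancel := by
      intro f
      change (-1 : ℚ) • f + f = 0
      nth_rewrite 2 [← one_smul ℚ f]
      rw [← add_smul]; simp }

theorem neg_op_apply (f : Op n) (v : E n ⊗[ℚ] E n) : (-f) v = (-1 : ℚ) • f v := rfl

/-- The operator `a ⊗ f`. -/
noncomputable def op (a : E n) (f : Module.End ℚ (E n)) : Op n :=
  TensorProduct.map (LinearMap.mulLeft ℚ a) f

theorem op_tmul (a : E n) (f : Module.End ℚ (E n)) (b c : E n) :
    op a f (b ⊗ₜ c) = (a * b) ⊗ₜ f c := by simp [op]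

theorem op_mul (a b : E n) (f g : Module.End ℚ (E n)) :
    op a f * op b g = op (a * b) (f * g) := by
  apply TensorProduct.ext'
  intro u v
  simp [op_tmul, mul_assoc]

theorem op_zero_left (f : Module.End ℚ (E n)) : op 0 f = 0 := by
  apply TensorProduct.ext'
  intro u v
  simp [op_tmul]

theorem op_zero_right (a : E n) : op a 0 = 0 := by
  apply TensorProduct.ext'
  intro u v
  simp [op_tmul]

theorem op_neg_left (a : E n) (f : Module.End ℚ (E n)) : op (-a) f = - op a f := by
  apply TensorProduct.ext'
  intro u v
  rw [neg_op_apply, op_tmul, op_tmul, smul_tmul', neg_one_smul]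
  exact congrArg (· ⊗ₜ[ℚ] f v) (neg_mul a u)

theorem op_neg_right (a : E n) (f : Module.End ℚ (E n)) : op a (-f) = - op a f := by
  apply TensorProduct.ext'
  intro u v
  rw [neg_op_apply, op_tmul, op_tmul, ← tmul_smul, neg_one_smul]; rfl

theorem op_add_left (a b : E n) (f : Module.End ℚ (E n)) : op (a + b) f = op a f + op b f := by
  apply TensorProduct.ext'
  intro u v
  simp [op_tmul, add_mul, add_tmul]

theorem op_add_right (a : E n) (f g : Module.End ℚ (E n)) : op a (f + g) = op a f + op a g := by
  apply TensorProduct.ext'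
  intro u v
  simp [op_tmul, tmul_add]

/-- Left multiplication. -/
noncomputable abbrev L (a : E n) : Module.End ℚ (E n) := LinearMap.mulLeft ℚ a

/-- The action of a permutation as a linear operator. -/
noncomputable abbrev S (s : Equiv.Perm (Fin n)) : Module.End ℚ (E n) := (act s).toLinearMap

theorem S_mul (s t : Equiv.Perm (Fin n)) : (S s : Module.End ℚ (E n)) * S t = S (s * t) := by
  ext a; simp [act_act]

theorem S_L (s : Equiv.Perm (Fin n)) (a : E n) : S s * L a = L (act s a) * S s := by
  ext b; simp

theorem L_mul (a b : E n) : L a * L b = L (a * b) := by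
  ext c; simp [mul_assoc]

theorem L_neg_mul (a : E n) (f : Module.End ℚ (E n)) : L (-a) * f = - (L a * f) := by
  ext c; exact neg_mul a (f c)

theorem L_neg (a : E n) : L (-a) = - L a := by
  ext c; exact neg_mul a c

theorem L_add (a b : E n) : L (a + b) = L a + L b := by
  ext c; simp [add_mul]

theorem L_zero : L (0 : E n) = 0 := by
  ext c; simp

/-- The operator `x_{ij} ⊗ s_{ij}`. -/
noncomputable def oX (i j : Fin n) : Op n := op (x n i j) (S (Equiv.swap i j))

/-- The operator `1 ⊗ x_{ij}`. -/
noncomputable def oY (i j : Fin n) : Op n := op 1 (L (x n i j))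

theorem oX_mul_oX (i j k l : Fin n) : oX i j * oX k l =
    op (x n i j * x n k l) (S (Equiv.swap i j * Equiv.swap k l)) := by
  rw [oX, oX, op_mul, S_mul]

theorem oX_mul_oY (i j k l : Fin n) : oX i j * oY k l =
    op (x n i j) (L (x n (Equiv.swap i j k) (Equiv.swap i j l)) * S (Equiv.swap i j)) := by
  rw [oX, oY, op_mul, S_L, act_x, mul_one]

theorem oY_mul_oX (i j k l : Fin n) : oY i j * oX k l =
    op (x n k l) (L (x n i j) * S (Equiv.swap k l)) := by
  rw [oX, oY, op_mul, one_mul]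

theorem oY_mul_oY (i j k l : Fin n) : oY i j * oY k l = op 1 (L (x n i j * x n k l)) := by
  rw [oY, oY, op_mul, one_mul, L_mul]

/-- Linear polynomials. -/
noncomputable def lin {R : Type*} [Ring R] (a b : R) : R[X] := C a * X + C b

theorem lin_mul {R : Type*} [Ring R] (a b c d : R) :
    lin a b * lin c d = C (a * c) * X ^ 2 + C (a * d + b * c) * X + C (b * d) := by
  simp only [lin, mul_add, add_mul, C_mul, C_add]
  have h1 : C a * X * (C c * X) = C a * C c * X ^ 2 := by
    rw [mul_assoc, ← mul_assoc X, X_mul_C]; simp only [mul_assoc, sq]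
  have h2 : C a * X * C d = C a * C d * X := by
    rw [mul_assoc, X_mul_C, mul_assoc]
  rw [h1, h2, ← mul_assoc]
  abel

theorem good_lin : Good (fun i j : Fin n => lin (oX i j) (oY i j)) where
  diag i := by simp [lin, oX, oY, x_self, op_zero_left, L_zero, op_zero_right]
  anti i j _ := by
    simp only [lin, oX, oY, x_anti i j, op_neg_left, L_neg, op_neg_right, Equiv.swap_comm j i,
      C_neg]
    rw [neg_mul, neg_add]
  sq i j _ := by
    simp only [lin_mul, oX_mul_oX, oX_mul_oY, oY_mul_oX, oY_mul_oY, x_sq, Equiv.swap_apply_left,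
      Equiv.swap_apply_right, op_zero_left, L_zero, op_zero_right, x_anti i j, L_neg_mul,
      op_neg_right]
    simp
  comm i j k l h := by
    simp only [List.nodup_cons, List.mem_cons, List.not_mem_nil, or_false, not_or] at h
    obtain ⟨⟨h1, h2, h3⟩, ⟨h4, h5⟩, h6, -⟩ := h
    have hs : Equiv.swap i j * Equiv.swap k l = Equiv.swap k l * Equiv.swap i j := by
      apply Equiv.Perm.Disjoint.commute
      rw [Equiv.Perm.disjoint_iff_disjoint_support, Equiv.Perm.support_swap h1,
        Equiv.Perm.support_swap h6]
      simp [h2, h3, h4, h5, Ne.symm h2, Ne.symm h3, Ne.symm h4, Ne.symm h5]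
    have hx := x_comm i j k l (by simp [h1, h2, h3, h4, h5, h6])
    simp only [lin_mul, oX_mul_oX, oX_mul_oY, oY_mul_oX, oY_mul_oY, hx, hs]
    rw [Equiv.swap_apply_of_ne_of_ne (Ne.symm h2) (Ne.symm h4),
      Equiv.swap_apply_of_ne_of_ne (Ne.symm h3) (Ne.symm h5),
      Equiv.swap_apply_of_ne_of_ne h2 h3, Equiv.swap_apply_of_ne_of_ne h4 h5, add_comm (op _ _)]
  cyc i j k h := by
    have hx := x_cyc i j k h
    simp only [List.nodup_cons, List.mem_cons, List.not_mem_nil, or_false, not_or] at h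
    obtain ⟨⟨h1, h2⟩, h3, -⟩ := h
    have hs1 : Equiv.swap j k * Equiv.swap k i = Equiv.swap i j * Equiv.swap j k := by
      ext a; simp only [Equiv.Perm.mul_apply, Equiv.swap_apply_def]; grind
    have hs2 : Equiv.swap k i * Equiv.swap i j = Equiv.swap i j * Equiv.swap j k := by
      ext a; simp only [Equiv.Perm.mul_apply, Equiv.swap_apply_def]; grind
    simp only [lin_mul, oX_mul_oX, oX_mul_oY, oY_mul_oX, oY_mul_oY, hs1, hs2,
      Equiv.swap_apply_left, Equiv.swap_apply_right]
    rw [Equiv.swap_apply_of_ne_of_ne (Ne.symm h2) (Ne.symm h3),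
      Equiv.swap_apply_of_ne_of_ne h1 h2,
      Equiv.swap_apply_of_ne_of_ne h3 (Ne.symm h1), x_anti k i, x_anti i j, x_anti j k]
    simp only [L_neg_mul, op_neg_right]
    have e1 : op (x n i j * x n j k) (S (Equiv.swap i j * Equiv.swap j k))
        + op (x n j k * x n k i) (S (Equiv.swap i j * Equiv.swap j k))
        + op (x n k i * x n i j) (S (Equiv.swap i j * Equiv.swap j k)) = 0 := by
      rw [← op_add_left, ← op_add_left, hx, op_zero_left]
    have e2 : op 1 (L (x n i j * x n j k)) + op 1 (L (x n j k * x n k i))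
        + op 1 (L (x n k i * x n i j)) = 0 := by
      rw [← op_add_right, ← op_add_right, ← L_add, ← L_add, hx, L_zero, op_zero_right]
    have aux : ∀ {R : Type} [Ring R] (a b c u v w p q r : R), a + b + c = 0 → p + q + r = 0 →
        u + v + w = 0 →
        (C a * X ^ 2 + C u * X + C p) + (C b * X ^ 2 + C v * X + C q)
          + (C c * X ^ 2 + C w * X + C r) = (0 : R[X]) := by
      intro R _ a b c u v w p q r ha hp hu
      calc _ = C (a + b + c) * X ^ 2 + C (u + v + w) * X + C (p + q + r) := by
            simp only [C_add, add_mul]; abel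
        _ = 0 := by rw [ha, hp, hu]; simp
    refine aux _ _ _ _ _ _ _ _ _ e1 e2 ?_
    abel

/-- The braided coproduct, with values in polynomials of operators. -/
noncomputable def phi : E n →ₐ[ℚ] (Op n)[X] := liftE _ good_lin

theorem phi_x (i j : Fin n) : phi (x n i j) = lin (oX i j) (oY i j) := liftE_x _ _ _ _

theorem good_grade : Good (fun i j : Fin n => lin (x n i j) 0) where
  diag i := by simp [lin, x_self]
  anti i j _ := by simp [lin, x_anti i j]
  sq i j _ := by simp [lin_mul, x_sq]
  comm i j k l h := by simp [lin_mul, x_comm i j k l h]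
  cyc i j k h := by
    simp only [lin_mul, mul_zero, zero_mul, add_zero, C_0]
    rw [← add_mul, ← add_mul, ← C_add, ← C_add, x_cyc i j k h]; simp

/-- The grading homomorphism `x_{ij} ↦ t x_{ij}`. -/
noncomputable def gr : E n →ₐ[ℚ] (E n)[X] := liftE _ good_grade

theorem gr_x (i j : Fin n) : gr (x n i j) = lin (x n i j) 0 := liftE_x _ _ _ _

theorem word_cons (p : Fin n × Fin n) (l : List (Fin n × Fin n)) :
    word n (p :: l) = x n p.1 p.2 * word n l := by simp [word]

theorem gr_word (l : List (Fin n × Fin n)) : gr (word n l) = C (word n l) * X ^ l.length := by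
  induction l with
  | nil => simp [word]
  | cons p l ih =>
    rw [word_cons, map_mul, ih, gr_x, lin, C_0, add_zero, mul_assoc, ← mul_assoc X, X_mul_C,
      C_mul, List.length_cons, pow_succ']
    simp only [mul_assoc]

theorem gr_coeff_word (l : List (Fin n × Fin n)) (e : ℕ) :
    (gr (word n l)).coeff e = if e = l.length then word n l else 0 := by
  rw [gr_word, coeff_C_mul_X_pow]

/-- The span of words of length `e` in the edges of `G`. -/
def wspan (G : SimpleGraph (Fin n)) (e : ℕ) : Submodule ℚ (E n) :=
  Submodule.span ℚ {y | ∃ l : List (Fin n × Fin n),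
    (∀ p ∈ l, G.Adj p.1 p.2) ∧ l.length = e ∧ y = word n l}

theorem EG_le (G : SimpleGraph (Fin n)) : (EG n G).toSubmodule ≤
    Submodule.span ℚ {y | ∃ l : List (Fin n × Fin n), (∀ p ∈ l, G.Adj p.1 p.2) ∧ y = word n l} := by
  rw [EG, Algebra.adjoin_eq_span]
  apply Submodule.span_mono
  intro y hy
  induction hy using Submonoid.closure_induction_left with
  | one => exact ⟨[], by simp, by simp [word]⟩
  | mul_left a ha b hb ih =>
    obtain ⟨i, j, hij, rfl⟩ := ha
    obtain ⟨l, hl, rfl⟩ := ih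
    refine ⟨(i, j) :: l, ?_, by rw [word_cons]⟩
    simpa [hij] using hl

theorem gr_coeff_deg (e : ℕ) (Q : E n) (hQ : Q ∈ degSpan n e) : (gr Q).coeff e = Q := by
  induction hQ using Submodule.span_induction with
  | mem y hy => obtain ⟨l, -, rfl, rfl⟩ := hy; simp [gr_coeff_word]
  | zero => simp
  | add a b _ _ ha hb => simp [ha, hb]
  | smul r a _ ha => simp [ha]

theorem EGdeg_le (G : SimpleGraph (Fin n)) (e : ℕ) : EGdeg n G e ≤ wspan G e := by
  rintro Q ⟨hQ, hd⟩
  rw [← gr_coeff_deg e Q hd]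
  have := EG_le G hQ
  clear hQ hd
  induction this using Submodule.span_induction with
  | mem y hy =>
    obtain ⟨l, hl, rfl⟩ := hy
    rw [gr_coeff_word]
    split_ifs with h
    · exact Submodule.subset_span ⟨l, hl, h.symm, rfl⟩
    · exact Submodule.zero_mem _
  | zero => simp
  | add a b _ _ ha hb => simpa using Submodule.add_mem _ ha hb
  | smul r a _ ha => simpa using Submodule.smul_mem _ r ha

/-- The components of the coproduct of `P`. -/
noncomputable def D (P : E n) (a : ℕ) : E n ⊗[ℚ] E n := (phi P).coeff a (1 ⊗ₜ 1)

theorem lin_mul_coeff {R : Type*} [Ring R] (a b : R) (p : R[X]) (k : ℕ) :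
    (lin a b * p).coeff (k + 1) = a * p.coeff k + b * p.coeff (k + 1) := by
  simp [lin, add_mul, mul_assoc]

theorem lin_mul_coeff_zero {R : Type*} [Ring R] (a b : R) (p : R[X]) :
    (lin a b * p).coeff 0 = b * p.coeff 0 := by
  simp [lin, add_mul, mul_assoc]

theorem phi_coeff_zero (P : E n) : (phi P).coeff 0 = op 1 (L P) := by
  induction P using E_induction with
  | halg r =>
    rw [AlgHom.commutes, Polynomial.algebraMap_apply, coeff_C_zero]
    apply TensorProduct.ext'
    intro u v
    simp [op_tmul, Algebra.algebraMap_eq_smul_one]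
  | hx i j => simp [phi_x, lin, oY]
  | hmul a b ha hb => rw [map_mul, mul_coeff_zero, ha, hb, op_mul, L_mul, mul_one]
  | hadd a b ha hb => rw [map_add, coeff_add, ha, hb, L_add, op_add_right]

theorem D_zero (P : E n) : D P 0 = 1 ⊗ₜ P := by
  simp [D, phi_coeff_zero, op_tmul]

theorem D_word (l : List (Fin n × Fin n)) :
    (∃ s, (phi (word n l)).coeff l.length = op (word n l) (S s)) ∧
    ∀ e, l.length < e → (phi (word n l)).coeff e = 0 := by
  induction l with
  | nil =>
    constructor
    · refine ⟨1, ?_⟩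
      apply TensorProduct.ext'
      intro u v
      simp [op_tmul, word, act_one]
    · intro e he
      have : e ≠ 0 := by simp at he; omega
      simp [word, coeff_one, this]
  | cons p l ih =>
    obtain ⟨⟨s, hs⟩, h0⟩ := ih
    constructor
    · refine ⟨Equiv.swap p.1 p.2 * s, ?_⟩
      rw [word_cons, map_mul, phi_x, List.length_cons, lin_mul_coeff, hs, h0 _ (by omega),
        mul_zero, add_zero, oX, op_mul, S_mul]
    · intro e he
      obtain ⟨e, rfl⟩ : ∃ k, e = k + 1 := ⟨e - 1, by simp at he; omega⟩
      simp only [List.length_cons] at he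
      rw [word_cons, map_mul, phi_x, lin_mul_coeff, h0 _ (by omega), h0 _ (by omega)]
      simp

theorem D_deg (d : ℕ) (P : E n) (hP : P ∈ degSpan n d) :
    D P d = P ⊗ₜ 1 ∧ ∀ e, d < e → D P e = 0 := by
  induction hP using Submodule.span_induction with
  | mem y hy =>
    obtain ⟨l, -, rfl, rfl⟩ := hy
    obtain ⟨⟨s, hs⟩, h0⟩ := D_word l
    constructor
    · simp [D, hs, op_tmul]
    · intro e he; simp [D, h0 e he]
  | zero => simp [D]
  | add a b _ _ ha hb =>
    have hD : ∀ e, D (a + b) e = D a e + D b e := by intro e; simp [D]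
    refine ⟨by rw [hD, ha.1, hb.1, add_tmul], fun e he => ?_⟩
    rw [hD, ha.2 e he, hb.2 e he, add_zero]
  | smul r a _ ha =>
    have hD : ∀ e, D (r • a) e = r • D a e := by intro e; simp [D]
    refine ⟨by rw [hD, ha.1, smul_tmul'], fun e he => ?_⟩
    rw [hD, ha.2 e he, smul_zero]

theorem D_step (P : E n) (i j : Fin n) (h : x n i j * P = 0) (a : ℕ) :
    oX i j (D P a) = (-1 : ℚ) • oY i j (D P (a + 1)) := by
  have h1 : phi (x n i j * P) = 0 := by rw [h, map_zero]
  rw [map_mul, phi_x] at h1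
  have h2 := congrArg (fun q : (Op n)[X] => q.coeff (a + 1) (1 ⊗ₜ 1)) h1
  simp only [lin_mul_coeff] at h2
  change oX i j (D P a) + oY i j (D P (a + 1)) = 0 at h2
  have h3 : (-1 : ℚ) • oY i j (D P (a + 1)) + oY i j (D P (a + 1)) = 0 := by
    nth_rewrite 2 [← one_smul ℚ (oY i j (D P (a + 1)))]
    rw [← add_smul]; simp
  calc oX i j (D P a) = oX i j (D P a) + ((-1 : ℚ) • oY i j (D P (a + 1))
        + oY i j (D P (a + 1))) := by rw [h3, add_zero]
    _ = (-1 : ℚ) • oY i j (D P (a + 1)) + (oX i j (D P a) + oY i j (D P (a + 1))) := by abel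
    _ = _ := by rw [h2, add_zero]

theorem key (G : SimpleGraph (Fin n)) (P : E n)
    (h : ∀ i j : Fin n, G.Adj i j → x n i j * P = 0) (l : List (Fin n × Fin n))
    (hl : ∀ p ∈ l, G.Adj p.1 p.2) :
    ∃ (s : Equiv.Perm (Fin n)) (W : Module.End ℚ (E n)),
      word n l ⊗ₜ[ℚ] act s P = op 1 W (D P l.length) := by
  induction l with
  | nil => exact ⟨1, 1, by simp [D_zero, op_tmul, word, act_one]⟩
  | cons p l ih =>
    obtain ⟨s, W, hW⟩ := ih (fun q hq => hl q (by simp [hq]))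
    have hp := hl p (by simp)
    set t := Equiv.swap p.1 p.2 with ht
    have htt : S t * S t = (1 : Module.End ℚ (E n)) := by
      rw [S_mul, ht, Equiv.swap_mul_self]; ext a; simp [act_one]
    refine ⟨t * s, -(S t * W * S t * L (x n p.1 p.2)), ?_⟩
    have e1 : word n (p :: l) ⊗ₜ[ℚ] act (t * s) P
        = oX p.1 p.2 (word n l ⊗ₜ[ℚ] act s P) := by
      rw [oX, op_tmul, word_cons, ← act_act]; rfl
    have e2 : oX p.1 p.2 * op 1 W = op 1 (S t * W * S t) * oX p.1 p.2 := by
      rw [oX, op_mul, op_mul, mul_one, one_mul, mul_assoc, ← ht, htt, mul_one]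
    rw [e1, hW, ← Module.End.mul_apply, e2, Module.End.mul_apply, D_step P _ _ (h _ _ hp),
      op_neg_right, neg_op_apply, map_smul, ← Module.End.mul_apply, oY, op_mul, one_mul, List.length_cons]

theorem act_ne_zero (s : Equiv.Perm (Fin n)) (P : E n) (hP : P ≠ 0) : act s P ≠ 0 := by
  intro h0
  apply hP
  rw [← act_one P, ← inv_mul_cancel s, ← act_act, h0, map_zero]

/-- Contract the second factor. -/
theorem contract (v : E n) (hv : v ≠ 0) : ∃ F : E n ⊗[ℚ] E n →ₗ[ℚ] E n,
    (∀ a, F (a ⊗ₜ v) = a) ∧ ∀ a b, ∃ c : ℚ, F (a ⊗ₜ b) = c • a := by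
  obtain ⟨g, hg⟩ := Module.Projective.exists_dual_ne_zero ℚ hv
  obtain ⟨f, hf⟩ : ∃ f : Module.Dual ℚ (E n), f v = 1 :=
    ⟨(g v)⁻¹ • g, by simp [inv_mul_cancel₀ hg]⟩
  refine ⟨(TensorProduct.rid ℚ (E n)).toLinearMap ∘ₗ TensorProduct.map LinearMap.id f, ?_, ?_⟩
  · intro a; simp [hf]
  · intro a b; exact ⟨f b, by simp⟩

theorem word_eq_zero (G : SimpleGraph (Fin n)) (P : E n) (hP : P ≠ 0)
    (h : ∀ i j : Fin n, G.Adj i j → x n i j * P = 0) (l : List (Fin n × Fin n))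
    (hl : ∀ p ∈ l, G.Adj p.1 p.2) (hD : D P l.length = 0) : word n l = 0 := by
  obtain ⟨s, W, hW⟩ := key G P h l hl
  obtain ⟨F, hF, -⟩ := contract _ (act_ne_zero s P hP)
  rw [← hF (word n l), hW, hD, map_zero, map_zero]

theorem main (G : SimpleGraph (Fin n)) (P : E n) (hP : P ≠ 0)
    (h : ∀ i j : Fin n, G.Adj i j → x n i j * P = 0) :
    FiniteDimensional ℚ ↥(EG n G) ∧
    (∀ d : ℕ, P ∈ EG n G → P ∈ degSpan n d →
      (∀ e : ℕ, d < e → EGdeg n G e = ⊥) ∧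
      EGdeg n G d = Submodule.span ℚ {P}) := by
  constructor
  · have hfin : (word n '' {l : List (Fin n × Fin n) | l.length ≤ (phi P).natDegree}).Finite :=
      (List.finite_length_le _ _).image _
    have hle : (EG n G).toSubmodule ≤ Submodule.span ℚ
        (word n '' {l : List (Fin n × Fin n) | l.length ≤ (phi P).natDegree}) := by
      refine (EG_le G).trans (Submodule.span_le.2 ?_)
      rintro y ⟨l, hl, rfl⟩
      by_cases hlen : l.length ≤ (phi P).natDegree
      · exact Submodule.subset_span ⟨l, hlen, rfl⟩
      · rw [word_eq_zero G P hP h l hl]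
        · exact Submodule.zero_mem _
        · rw [D, coeff_eq_zero_of_natDegree_lt (not_le.1 hlen)]; rfl
    haveI := FiniteDimensional.span_of_finite ℚ hfin
    exact Submodule.finiteDimensional_of_le hle
  · intro d hPG hPd
    obtain ⟨hD, hD0⟩ := D_deg d P hPd
    constructor
    · intro e he
      rw [eq_bot_iff]
      refine (EGdeg_le G e).trans (Submodule.span_le.2 ?_)
      rintro y ⟨l, hl, rfl, rfl⟩
      exact word_eq_zero G P hP h l hl (hD0 _ he)
    · apply le_antisymm
      · refine (EGdeg_le G d).trans (Submodule.span_le.2 ?_)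
        rintro y ⟨l, hl, rfl, rfl⟩
        obtain ⟨s, W, hW⟩ := key G P h l hl
        obtain ⟨F, hF, hF2⟩ := contract _ (act_ne_zero s P hP)
        rw [hD, op_tmul, one_mul] at hW
        obtain ⟨c, hc⟩ := hF2 P (W 1)
        rw [← hF (word n l), hW, hc]
        exact Submodule.smul_mem _ _ (Submodule.mem_span_singleton_self P)
      · rw [Submodule.span_singleton_le_iff_mem]
        exact ⟨hPG, hPd⟩

end Proof

/-- if there is a nonzero `P ∈ E n` with `x_{ij}·P = 0` for every edge
`{i,j}` of `G`, then `E_G` is finite-dimensional; if moreover `P ∈ E_G` is homogeneous of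
degree `d`, then `E_G^e = 0` for `e > d` and `E_G^d = ℚ·P`. -/
theorem stmt5 (n : ℕ) (hn : 1 ≤ n) (G : SimpleGraph (Fin n))
    (P : E n) (hP : P ≠ 0)
    (h : ∀ i j : Fin n, G.Adj i j → x n i j * P = 0) :
    FiniteDimensional ℚ ↥(EG n G) ∧
    (∀ d : ℕ, P ∈ EG n G → P ∈ degSpan n d →
      (∀ e : ℕ, d < e → EGdeg n G e = ⊥) ∧
      EGdeg n G d = Submodule.span ℚ {P}) := by
  exact main G P hP h

end FK
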